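/- arXiv:2310.15681 — 2 statements merged into one kernel-verified Lean document; each statement's English description precedes it below -/
import Mathlib

section
/- Let d ≥ 1 and let Δ_(1) ≤ Δ_(2) ≤ … ≤ Δ_(d) be positive real numbers. Define H = ∑_{s=1}^{d} 1/Δ_(s)² and H₂ = max_{s ∈ [d]} s/Δ_(s)². Then H₂ ≤ H ≤ log₂(2d) · H₂. -/
/-- The harmonic numbers are bounded by `log₂ (2d)`. -/
theorem sum_one_div_succ_le_logb (d : ℕ) (hd : 1 ≤ d) :
    ∑ s : Fin d, 1 / ((s : ℕ) + 1 : ℝ) ≤ Real.logb 2 (2 * d) := by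
  have hd' : (1 : ℝ) ≤ d := by exact_mod_cast hd
  have hharm : ∑ s : Fin d, 1 / ((s : ℕ) + 1 : ℝ) = (harmonic d : ℝ) := by
    rw [Fin.sum_univ_eq_sum_range (fun s : ℕ => 1 / ((s : ℝ) + 1)) d]
    simp [harmonic]
  have hlog : Real.log d ≤ Real.logb 2 d := by
    refine le_div_self (Real.log_nonneg hd') (Real.log_pos one_lt_two) ?_
    linarith [Real.log_two_lt_d9]
  rw [hharm, Real.logb_mul two_ne_zero (by positivity), Real.logb_self_eq_one one_lt_two]
  linarith [harmonic_le_one_add_log d]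

/-- `H₂` is equivalent to `H` up to a logarithmic factor: if
`Δ_(1) ≤ … ≤ Δ_(d)` are positive, `H = ∑_s 1/Δ_(s)²` and
`H₂ = max_{s ∈ [d]} s/Δ_(s)²`, then `H₂ ≤ H ≤ log₂(2d) · H₂`.
(Here index `s ∈ [d]` corresponds to `(s : Fin d)` with value `s + 1`.) -/
theorem H2_equiv_H (d : ℕ) (hd : 1 ≤ d) (Δ : Fin d → ℝ)
    (hpos : ∀ s, 0 < Δ s) (hmono : Monotone Δ)
    (H H₂ : ℝ)
    (hH : H = ∑ s, 1 / (Δ s) ^ 2)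
    (hH₂ : H₂ = Finset.univ.sup' (Finset.univ_nonempty_iff.mpr ⟨⟨0, hd⟩⟩)
      (fun s : Fin d => ((s : ℕ) + 1 : ℝ) / (Δ s) ^ 2)) :
    H₂ ≤ H ∧ H ≤ Real.logb 2 (2 * d) * H₂ := by
  subst hH hH₂
  refine ⟨Finset.sup'_le _ _ fun s _ => ?_, ?_⟩
  · calc ((s : ℕ) + 1 : ℝ) / (Δ s) ^ 2
        = ∑ _t ∈ Finset.Iic s, 1 / (Δ s) ^ 2 := by
          simp [Finset.sum_const, div_eq_mul_inv]
      _ ≤ ∑ t ∈ Finset.Iic s, 1 / (Δ t) ^ 2 := by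
          refine Finset.sum_le_sum fun t ht => ?_
          have := hpos t
          have := hmono (Finset.mem_Iic.mp ht)
          gcongr
      _ ≤ ∑ t, 1 / (Δ t) ^ 2 :=
          Finset.sum_le_sum_of_subset_of_nonneg (Finset.subset_univ _)
            fun t _ _ => by positivity
  · set M := Finset.univ.sup' (Finset.univ_nonempty_iff.mpr ⟨⟨0, hd⟩⟩)
      (fun s : Fin d => ((s : ℕ) + 1 : ℝ) / (Δ s) ^ 2)
    have hM (s : Fin d) : ((s : ℕ) + 1 : ℝ) / (Δ s) ^ 2 ≤ M :=
      Finset.le_sup' (fun s : Fin d => ((s : ℕ) + 1 : ℝ) / (Δ s) ^ 2) (Finset.mem_univ s)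
    have hM0 : 0 ≤ M := le_trans (by positivity) (hM ⟨0, hd⟩)
    calc ∑ s, 1 / (Δ s) ^ 2
        = ∑ s : Fin d, 1 / ((s : ℕ) + 1 : ℝ) * (((s : ℕ) + 1 : ℝ) / (Δ s) ^ 2) := by
          refine Finset.sum_congr rfl fun s _ => ?_
          have := (hpos s).ne'
          field_simp
      _ ≤ ∑ s : Fin d, 1 / ((s : ℕ) + 1 : ℝ) * M :=
          Finset.sum_le_sum fun s _ => mul_le_mul_of_nonneg_left (hM s) (by positivity)
      _ = (∑ s : Fin d, 1 / ((s : ℕ) + 1 : ℝ)) * M := by rw [Finset.sum_mul]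
      _ ≤ Real.logb 2 (2 * d) * M :=
          mul_le_mul_of_nonneg_right (sum_one_div_succ_le_logb d hd) hM0
end

section
/- Let d ≥ 1, let μ̂, μ, χ ∈ ℝ^d, let e ∈ [d], and let Δ > 0, U > 0, L > 0, w > 0 be real numbers. Suppose χ_e > 0, |μ̂_s − μ_s| < Δ/((2 + L²)·U) for every s ∈ [d], ⟨μ, χ⟩ ≥ 0, ∑_{s=1}^{d} |χ_s| ≤ U·χ_e, and χ_e ≤ L·w. Then −⟨μ̂, χ⟩ / w ≤ (L/(2 + L²)) · Δ. -/
/-- Hölder's inequality for the `ℓ∞`/`ℓ¹` pairing: if `u` and `v` are within `ε` coordinatewise, then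
replacing `u` by `v` lowers the pairing with `x` by at most `ε` times the `ℓ¹` norm of `x`. -/
theorem sum_mul_sub_sum_mul_le_of_abs_sub_le {ι : Type*} [Fintype ι] {u v x : ι → ℝ} {ε : ℝ}
    (h : ∀ i, |v i - u i| ≤ ε) :
    ∑ i, u i * x i - ∑ i, v i * x i ≤ ε * ∑ i, |x i| := by
  rw [← Finset.sum_sub_distrib, Finset.mul_sum]
  refine Finset.sum_le_sum fun i _ => ?_
  calc u i * x i - v i * x i = (u i - v i) * x i := by ring
    _ ≤ |u i - v i| * |x i| := (le_abs_self _).trans (abs_mul _ _).le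
    _ ≤ ε * |x i| := by
      rw [abs_sub_comm]
      exact mul_le_mul_of_nonneg_right (h i) (abs_nonneg _)

/-- Deterministic inequality chain inside Lemma 21 of the paper: under the
per-coordinate confidence event `|μ̂_s − μ_s| < Δ/((2+L²)U)`, a direction `χ`
with `χ_e > 0`, nonnegative true reward `⟨μ, χ⟩ ≥ 0`, `‖χ‖₁ ≤ U·χ_e` and
`χ_e ≤ L·w` has `−⟨μ̂, χ⟩/w ≤ L/(2+L²)·Δ`. -/
theorem lemma21_inequality (d : ℕ) (hd : 1 ≤ d)
    (μhat μ χ : Fin d → ℝ) (e : Fin d)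
    (Δ U L w : ℝ) (hΔ : 0 < Δ) (hU : 0 < U) (hL : 0 < L) (hw : 0 < w)
    (hχe : 0 < χ e)
    (hconf : ∀ s, |μhat s - μ s| < Δ / ((2 + L ^ 2) * U))
    (hrew : 0 ≤ ∑ s, μ s * χ s)
    (hl1 : ∑ s, |χ s| ≤ U * χ e)
    (hχew : χ e ≤ L * w) :
    -(∑ s, μhat s * χ s) / w ≤ (L / (2 + L ^ 2)) * Δ := by
  have hpair := sum_mul_sub_sum_mul_le_of_abs_sub_le (x := χ) fun s => (hconf s).le
  rw [div_le_iff₀ hw]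
  calc -(∑ s, μhat s * χ s) ≤ Δ / ((2 + L ^ 2) * U) * ∑ s, |χ s| := by linarith
    _ ≤ Δ / ((2 + L ^ 2) * U) * (U * (L * w)) := by
      gcongr
      exact hl1.trans (by gcongr)
    _ = L / (2 + L ^ 2) * Δ * w := by field_simp
end
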